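/- arXiv:1803.02448 — 3 statements merged into one kernel-verified Lean document; each statement's English description precedes it below -/
import Mathlib

section
/- Let H ∈ C¹(ℝ^m,ℝ^m) with ∂_iH_j = ∂_jH_i, and let u = (u_1,…,u_m), u_i ∈ C³(ℝ²), be a stable solution of Δ_G u_i = H_i(u) on ℝ² such that the system is orientable along u. Assume that for every i and every point of ℝ², (Z(Yu_i))·(Xu_i) − (Z(Xu_i))·(Yu_i) ≤ 0, and that there is a constant C with ∫_{B_R} x²·|∇_G u_i|² dxdy ≤ C·R⁴ for all R > 1 and all i. Then for every i and every point p with |∇_G u_i(p)| ≠ 0, the intrinsic curvature of the level set of u_i vanishes, 𝒜(u_i)(p) = 0, and moreover ℬ(u_i)(p) = 0. -/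
open MeasureTheory Real Filter

/-- Partial derivative in the `x`-variable. -/
noncomputable def pdx (u : ℝ × ℝ → ℝ) (p : ℝ × ℝ) : ℝ :=
  deriv (fun t => u (t, p.2)) p.1

/-- Partial derivative in the `y`-variable. -/
noncomputable def pdy (u : ℝ × ℝ → ℝ) (p : ℝ × ℝ) : ℝ :=
  deriv (fun t => u (p.1, t)) p.2

/-- The Grushin vector field `X u = ∂ₓ u`. -/
noncomputable def Xg (u : ℝ × ℝ → ℝ) (p : ℝ × ℝ) : ℝ := pdx u p

/-- The Grushin vector field `Y u = x·∂_y u`. -/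
noncomputable def Yg (u : ℝ × ℝ → ℝ) (p : ℝ × ℝ) : ℝ := p.1 * pdy u p

/-- The commutator field `Z u = ∂_y u`. -/
noncomputable def Zg (u : ℝ × ℝ → ℝ) (p : ℝ × ℝ) : ℝ := pdy u p

/-- The Grushin Laplacian `Δ_G u = X(Xu) + Y(Yu)`. -/
noncomputable def deltaG (u : ℝ × ℝ → ℝ) (p : ℝ × ℝ) : ℝ := Xg (Xg u) p + Yg (Yg u) p

/-- The norm of the Grushin gradient, `|∇_G u| = √((Xu)² + (Yu)²)`. -/
noncomputable def normG (u : ℝ × ℝ → ℝ) (p : ℝ × ℝ) : ℝ :=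
  Real.sqrt ((Xg u p) ^ 2 + (Yg u p) ^ 2)

/-- The `j`-th partial derivative of a function `H : ℝ^m → ℝ`. -/
noncomputable def pdH {m : ℕ} (H : (Fin m → ℝ) → ℝ) (j : Fin m) (v : Fin m → ℝ) : ℝ :=
  fderiv ℝ H v (Pi.single j 1)

/-- Intrinsic curvature `𝒜` of the level sets. -/
noncomputable def curvA (u : ℝ × ℝ → ℝ) (p : ℝ × ℝ) : ℝ :=
  ((normG u p) ^ 3)⁻¹ *
    (Xg (Xg u) p * (Yg u p) ^ 2 - Xg (Yg u) p * Xg u p * Yg u p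
      - Yg (Xg u) p * Xg u p * Yg u p + Yg (Yg u) p * (Xg u p) ^ 2)

/-- Intrinsic tangential quantity `ℬ` of the level sets. -/
noncomputable def curvB (u : ℝ × ℝ → ℝ) (p : ℝ × ℝ) : ℝ :=
  ((normG u p) ^ 3)⁻¹ *
    (Xg (Xg u) p * Xg u p * Yg u p - Xg (Yg u) p * (Xg u p) ^ 2
      + Yg (Xg u) p * (Yg u p) ^ 2 - Yg (Yg u) p * Xg u p * Yg u p)

/-- The Grushin ball `B_R = {(x,y) : x⁴ + y² < R⁴}`. -/
def ballG (R : ℝ) : Set (ℝ × ℝ) := {p : ℝ × ℝ | p.1 ^ 4 + p.2 ^ 2 < R ^ 4}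

/-- The Grushin norm `‖(x,y)‖_G = (x⁴+y²)^(1/4)`. -/
noncomputable def grushinNorm (p : ℝ × ℝ) : ℝ := (p.1 ^ 4 + p.2 ^ 2) ^ ((1 : ℝ) / 4)

section PartialDerivatives

variable {f g : ℝ × ℝ → ℝ}

lemma hasDerivAt_pdx {p : ℝ × ℝ} (hf : DifferentiableAt ℝ f p) :
    HasDerivAt (fun t => f (t, p.2)) (fderiv ℝ f p (1, 0)) p.1 := by
  have h : HasDerivAt (fun t : ℝ => (t, p.2)) ((1 : ℝ), (0 : ℝ)) p.1 :=
    (hasDerivAt_id p.1).prodMk (hasDerivAt_const p.1 p.2)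
  exact HasFDerivAt.comp_hasDerivAt (x := p.1) (f := fun t : ℝ => (t, p.2)) hf.hasFDerivAt h

lemma hasDerivAt_pdy {p : ℝ × ℝ} (hf : DifferentiableAt ℝ f p) :
    HasDerivAt (fun t => f (p.1, t)) (fderiv ℝ f p (0, 1)) p.2 := by
  have h : HasDerivAt (fun t : ℝ => (p.1, t)) ((0 : ℝ), (1 : ℝ)) p.2 :=
    (hasDerivAt_const p.2 p.1).prodMk (hasDerivAt_id p.2)
  exact HasFDerivAt.comp_hasDerivAt (x := p.2) (f := fun t : ℝ => (p.1, t)) hf.hasFDerivAt h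

lemma pdx_eq_fderiv (hf : Differentiable ℝ f) : pdx f = fun p => fderiv ℝ f p (1, 0) :=
  funext fun p => (hasDerivAt_pdx (hf p)).deriv

lemma pdy_eq_fderiv (hf : Differentiable ℝ f) : pdy f = fun p => fderiv ℝ f p (0, 1) :=
  funext fun p => (hasDerivAt_pdy (hf p)).deriv

lemma contDiff_pdx {n k : WithTop ℕ∞} (hf : ContDiff ℝ n f) (hk : k + 1 ≤ n) :
    ContDiff ℝ k (pdx f) := by
  rw [pdx_eq_fderiv (hf.differentiable (by rintro rfl; simp at hk))]
  exact (hf.fderiv_right hk).clm_apply contDiff_const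

lemma contDiff_pdy {n k : WithTop ℕ∞} (hf : ContDiff ℝ n f) (hk : k + 1 ≤ n) :
    ContDiff ℝ k (pdy f) := by
  rw [pdy_eq_fderiv (hf.differentiable (by rintro rfl; simp at hk))]
  exact (hf.fderiv_right hk).clm_apply contDiff_const

lemma contDiff_Xg {n k : WithTop ℕ∞} (hf : ContDiff ℝ n f) (hk : k + 1 ≤ n) :
    ContDiff ℝ k (Xg f) := contDiff_pdx hf hk

lemma contDiff_Yg {n k : WithTop ℕ∞} (hf : ContDiff ℝ n f) (hk : k + 1 ≤ n) :
    ContDiff ℝ k (Yg f) := contDiff_fst.mul (contDiff_pdy hf hk)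

lemma Xg_eq_fderiv (hf : Differentiable ℝ f) (p : ℝ × ℝ) : Xg f p = fderiv ℝ f p (1, 0) :=
  congrFun (pdx_eq_fderiv hf) p

lemma Yg_eq_fderiv (hf : Differentiable ℝ f) (p : ℝ × ℝ) :
    Yg f p = p.1 * fderiv ℝ f p (0, 1) := by
  rw [Yg, pdy_eq_fderiv hf]

lemma Xg_add (hf : Differentiable ℝ f) (hg : Differentiable ℝ g) (p : ℝ × ℝ) :
    Xg (fun q => f q + g q) p = Xg f p + Xg g p := by
  rw [Xg_eq_fderiv (hf.fun_add hg), Xg_eq_fderiv hf, Xg_eq_fderiv hg, fderiv_fun_add (hf p) (hg p)]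
  rfl

lemma Yg_add (hf : Differentiable ℝ f) (hg : Differentiable ℝ g) (p : ℝ × ℝ) :
    Yg (fun q => f q + g q) p = Yg f p + Yg g p := by
  rw [Yg_eq_fderiv (hf.fun_add hg), Yg_eq_fderiv hf, Yg_eq_fderiv hg, fderiv_fun_add (hf p) (hg p),
    ← mul_add]
  rfl

lemma Xg_mul (hf : Differentiable ℝ f) (hg : Differentiable ℝ g) (p : ℝ × ℝ) :
    Xg (fun q => f q * g q) p = f p * Xg g p + Xg f p * g p := by
  rw [Xg_eq_fderiv (hf.fun_mul hg), Xg_eq_fderiv hf, Xg_eq_fderiv hg, fderiv_fun_mul (hf p) (hg p)]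
  simp [mul_comm]

lemma Yg_mul (hf : Differentiable ℝ f) (hg : Differentiable ℝ g) (p : ℝ × ℝ) :
    Yg (fun q => f q * g q) p = f p * Yg g p + Yg f p * g p := by
  rw [Yg_eq_fderiv (hf.fun_mul hg), Yg_eq_fderiv hf, Yg_eq_fderiv hg, fderiv_fun_mul (hf p) (hg p)]
  simp
  ring

lemma Xg_comp {φ : ℝ → ℝ} {d : ℝ} (hf : Differentiable ℝ f) (p : ℝ × ℝ)
    (hφ : HasDerivAt φ d (f p)) : Xg (fun q => φ (f q)) p = d * Xg f p := by
  rw [Xg_eq_fderiv hf]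
  exact (HasDerivAt.comp (h := fun t => f (t, p.2)) p.1 hφ (hasDerivAt_pdx (hf p))).deriv

lemma Yg_comp {φ : ℝ → ℝ} {d : ℝ} (hf : Differentiable ℝ f) (p : ℝ × ℝ)
    (hφ : HasDerivAt φ d (f p)) : Yg (fun q => φ (f q)) p = d * Yg f p := by
  rw [Yg_eq_fderiv hf, mul_left_comm]
  exact congrArg (p.1 * ·)
    (HasDerivAt.comp (h := fun t => f (p.1, t)) p.2 hφ (hasDerivAt_pdy (hf p))).deriv

lemma pdy_pdx_comm (hf : ContDiff ℝ 2 f) (p : ℝ × ℝ) : pdy (pdx f) p = pdx (pdy f) p := by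
  have h1 := contDiff_pdx (k := 1) hf (by norm_num)
  have h2 := contDiff_pdy (k := 1) hf (by norm_num)
  have hd : Differentiable ℝ (fderiv ℝ f) :=
    (hf.fderiv_right (m := 1) (by norm_num)).differentiable (by norm_num)
  have hd0 := hf.differentiable (by norm_num)
  rw [pdy_eq_fderiv (h1.differentiable (by norm_num)),
    pdx_eq_fderiv (h2.differentiable (by norm_num)), pdx_eq_fderiv hd0, pdy_eq_fderiv hd0]
  have hs : IsSymmSndFDerivAt ℝ f p := hf.contDiffAt.isSymmSndFDerivAt (by simp)
  simp only [fderiv_clm_apply (hd p) (differentiableAt_const _)]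
  simpa using hs (0, 1) (1, 0)

lemma Zg_Xg_eq (hf : ContDiff ℝ 2 f) (p : ℝ × ℝ) : Zg (Xg f) p = pdx (pdy f) p :=
  pdy_pdx_comm hf p

lemma Zg_Yg_eq (hf : ContDiff ℝ 2 f) (p : ℝ × ℝ) : Zg (Yg f) p = p.1 * pdy (pdy f) p := by
  have h := hasDerivAt_pdy (p := p)
    ((contDiff_pdy (k := 1) hf (by norm_num)).differentiable (by norm_num) p)
  rw [pdy_eq_fderiv ((contDiff_pdy (k := 1) hf (by norm_num)).differentiable (by norm_num))]
  exact (h.const_mul p.1).deriv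

lemma pdx_fst_mul (hf : Differentiable ℝ f) (p : ℝ × ℝ) :
    pdx (fun q => q.1 * f q) p = f p + p.1 * pdx f p := by
  have h := Xg_mul differentiable_fst hf p
  have h1 : Xg (Prod.fst : ℝ × ℝ → ℝ) p = 1 := by simp [Xg, pdx]
  rw [h1] at h
  change pdx (fun q => q.1 * f q) p = p.1 * pdx f p + 1 * f p at h
  linarith

lemma pdy_fst_mul (hf : Differentiable ℝ f) (p : ℝ × ℝ) :
    pdy (fun q => q.1 * f q) p = p.1 * pdy f p := by
  rw [pdy_eq_fderiv hf]
  exact ((hasDerivAt_pdy (hf p)).const_mul p.1).deriv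

lemma Xg_deltaG (hf : ContDiff ℝ 3 f) (p : ℝ × ℝ) :
    Xg (deltaG f) p = deltaG (Xg f) p + 2 * Zg (Yg f) p := by
  have hx : ContDiff ℝ 2 (pdx f) := contDiff_pdx hf (by norm_num)
  have hy : ContDiff ℝ 2 (pdy f) := contDiff_pdy hf (by norm_num)
  have hxx : ContDiff ℝ 1 (pdx (pdx f)) := contDiff_pdx hx (by norm_num)
  have hyy : ContDiff ℝ 1 (pdy (pdy f)) := contDiff_pdy hy (by norm_num)
  have hxy : ContDiff ℝ 1 (pdy (pdx f)) := contDiff_pdy hx (by norm_num)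
  have e1 : deltaG f = fun q => pdx (pdx f) q + q.1 * (q.1 * pdy (pdy f) q) := by
    funext q
    simp only [deltaG, Yg, Xg]
    congr 2
    exact pdy_fst_mul (hy.differentiable (by norm_num)) q
  have dyy := hyy.differentiable (by norm_num)
  have dxy := hxy.differentiable (by norm_num)
  have e2 : deltaG (Xg f) p = pdx (pdx (pdx f)) p + p.1 * (p.1 * pdy (pdy (pdx f)) p) := by
    simp only [deltaG, Yg, Xg]
    congr 2
    exact pdy_fst_mul dxy p
  have e3 : pdy (pdx f) = pdx (pdy f) := funext (pdy_pdx_comm (hf.of_le (by norm_num)))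
  have e4 := pdy_pdx_comm hy p
  rw [e2, e3, e4, e1, Zg_Yg_eq (hf.of_le (by norm_num)),
    Xg_add (hxx.differentiable (by norm_num)) (by fun_prop)]
  simp only [Xg]
  rw [pdx_fst_mul (by fun_prop), pdx_fst_mul dyy]
  ring

lemma Yg_deltaG (hf : ContDiff ℝ 3 f) (p : ℝ × ℝ) :
    Yg (deltaG f) p = deltaG (Yg f) p - 2 * Zg (Xg f) p := by
  have hx : ContDiff ℝ 2 (pdx f) := contDiff_pdx hf (by norm_num)
  have hy : ContDiff ℝ 2 (pdy f) := contDiff_pdy hf (by norm_num)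
  have hxx : ContDiff ℝ 1 (pdx (pdx f)) := contDiff_pdx hx (by norm_num)
  have hyy : ContDiff ℝ 1 (pdy (pdy f)) := contDiff_pdy hy (by norm_num)
  have hyx : ContDiff ℝ 1 (pdx (pdy f)) := contDiff_pdx hy (by norm_num)
  have dx := hx.differentiable (by norm_num)
  have dy := hy.differentiable (by norm_num)
  have dxx := hxx.differentiable (by norm_num)
  have dyy := hyy.differentiable (by norm_num)
  have dyx := hyx.differentiable (by norm_num)
  have e0 : pdy (Yg f) = fun q => q.1 * pdy (pdy f) q := funext fun q => pdy_fst_mul dy q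
  have e0' : pdx (Yg f) = fun q => pdy f q + q.1 * pdx (pdy f) q :=
    funext fun q => pdx_fst_mul dy q
  have e1 : deltaG f = fun q => pdx (pdx f) q + q.1 * (q.1 * pdy (pdy f) q) := by
    funext q
    rw [deltaG, Yg, e0]
    rfl
  have e5 : Yg (Yg f) = fun q => q.1 * (q.1 * pdy (pdy f) q) := by
    funext q
    rw [Yg, e0]
  have e2 : deltaG (Yg f) p = 2 * pdx (pdy f) p + p.1 * pdx (pdx (pdy f)) p
      + p.1 * (p.1 * (p.1 * pdy (pdy (pdy f)) p)) := by
    have h1 : Xg (Xg (Yg f)) p = 2 * pdx (pdy f) p + p.1 * pdx (pdx (pdy f)) p := by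
      change Xg (pdx (Yg f)) p = _
      rw [e0', Xg_add dy (by fun_prop)]
      simp only [Xg]
      rw [pdx_fst_mul dyx]
      ring
    rw [deltaG, h1, e5, Yg, pdy_fst_mul (by fun_prop), pdy_fst_mul dyy]
  have e3 : pdy (pdx f) = pdx (pdy f) := funext (pdy_pdx_comm (hf.of_le (by norm_num)))
  have e4 := pdy_pdx_comm hx p
  rw [e3] at e4
  rw [e2, e1, Zg_Xg_eq (hf.of_le (by norm_num)), Yg_add dxx (by fun_prop)]
  simp only [Yg]
  rw [e4, pdy_fst_mul (by fun_prop), pdy_fst_mul dyy]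
  ring

lemma integral_fderiv_apply_eq_zero (hf : ContDiff ℝ 1 f) (hc : HasCompactSupport f)
    (v : ℝ × ℝ) : ∫ p, fderiv ℝ f p v = 0 := by
  have hi : Integrable (fun p => fderiv ℝ f p v) :=
    ((hf.continuous_fderiv (by norm_num)).clm_apply continuous_const).integrable_of_hasCompactSupport
      ((hc.fderiv (𝕜 := ℝ)).comp_left (g := fun L : ℝ × ℝ →L[ℝ] ℝ => L v) rfl)
  have h := integral_mul_fderiv_eq_neg_fderiv_mul_of_integrable (𝕜 := ℝ)
    (μ := (volume : Measure (ℝ × ℝ))) (f := fun _ => (1 : ℝ)) (g := f) (v := v)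
    (by simp) (by simpa using hi)
    (by simpa using hf.continuous.integrable_of_hasCompactSupport hc)
    (fun _ _ => differentiableAt_const _) (fun _ _ => hf.differentiable (by norm_num) _)
  simpa using h

lemma integral_Xg_eq_zero (hf : ContDiff ℝ 1 f) (hc : HasCompactSupport f) :
    ∫ p, Xg f p = 0 := by
  simp_rw [Xg_eq_fderiv (hf.differentiable (by norm_num))]
  exact integral_fderiv_apply_eq_zero hf hc _

lemma integral_Yg_eq_zero (hf : ContDiff ℝ 1 f) (hc : HasCompactSupport f) :
    ∫ p, Yg f p = 0 := by
  have hF : ContDiff ℝ 1 (fun q : ℝ × ℝ => q.1 * f q) := contDiff_fst.mul hf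
  have h := integral_fderiv_apply_eq_zero hF (hc.mul_left (f := Prod.fst)) (0, 1)
  rw [← h]
  refine integral_congr_ae (Eventually.of_forall fun p => ?_)
  have := congrFun (pdy_eq_fderiv (hF.differentiable (by norm_num))) p
  simp only [← this]
  rw [pdy_fst_mul (hf.differentiable (by norm_num))]
  rfl

end PartialDerivatives

section Stability

/-- The squared length of the Grushin gradient. -/
noncomputable def gradSq (f : ℝ × ℝ → ℝ) (p : ℝ × ℝ) : ℝ := Xg f p ^ 2 + Yg f p ^ 2

/-- A normalised measure of the failure of `∇_G f` to have locally constant direction. -/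
noncomputable def bending (f : ℝ × ℝ → ℝ) (p : ℝ × ℝ) : ℝ :=
  ((Xg (Xg f) p * Yg f p - Xg (Yg f) p * Xg f p) ^ 2
    + (Yg (Xg f) p * Yg f p - Yg (Yg f) p * Xg f p) ^ 2) / (gradSq f p + 1)

lemma gradSq_nonneg (f : ℝ × ℝ → ℝ) (p : ℝ × ℝ) : 0 ≤ gradSq f p := by
  unfold gradSq; positivity

lemma bending_nonneg (f : ℝ × ℝ → ℝ) (p : ℝ × ℝ) : 0 ≤ bending f p := by
  have := gradSq_nonneg f p
  unfold bending; positivity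

lemma normG_sq (f : ℝ × ℝ → ℝ) (p : ℝ × ℝ) : normG f p ^ 2 = gradSq f p :=
  Real.sq_sqrt (gradSq_nonneg f p)

lemma continuous_gradSq {f : ℝ × ℝ → ℝ} (hf : ContDiff ℝ 1 f) : Continuous (gradSq f) := by
  have h1 := (contDiff_Xg (k := 0) hf (by norm_num)).continuous
  have h2 := (contDiff_Yg (k := 0) hf (by norm_num)).continuous
  unfold gradSq; fun_prop

lemma continuous_bending {f : ℝ × ℝ → ℝ} (hf : ContDiff ℝ 2 f) : Continuous (bending f) := by
  have hA := contDiff_Xg (k := 1) hf (by norm_num)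
  have hB := contDiff_Yg (k := 1) hf (by norm_num)
  have h1 := (contDiff_Xg (k := 0) hA (by norm_num)).continuous
  have h2 := (contDiff_Yg (k := 0) hA (by norm_num)).continuous
  have h3 := (contDiff_Xg (k := 0) hB (by norm_num)).continuous
  have h4 := (contDiff_Yg (k := 0) hB (by norm_num)).continuous
  have h5 := hA.continuous
  have h6 := hB.continuous
  have h7 := continuous_gradSq (hf.of_le (by norm_num : (1 : WithTop ℕ∞) ≤ 2))
  unfold bending
  refine Continuous.div (by fun_prop) (by fun_prop) fun p => ?_
  have := gradSq_nonneg f p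
  positivity

lemma curv_eq_zero_of_bending_eq_zero {f : ℝ × ℝ → ℝ} {p : ℝ × ℝ} (h : bending f p = 0) :
    curvA f p = 0 ∧ curvB f p = 0 := by
  have hg := gradSq_nonneg f p
  unfold bending at h
  rw [div_eq_zero_iff, or_iff_left (by positivity)] at h
  have ha : Xg (Xg f) p * Yg f p - Xg (Yg f) p * Xg f p = 0 := by nlinarith
  have hb : Yg (Xg f) p * Yg f p - Yg (Yg f) p * Xg f p = 0 := by nlinarith
  constructor
  · unfold curvA
    refine mul_eq_zero_of_right _ ?_
    linear_combination Yg f p * ha - Xg f p * hb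
  · unfold curvB
    refine mul_eq_zero_of_right _ ?_
    linear_combination Xg f p * ha + Yg f p * hb

lemma integrable_of_vanishing {η F : ℝ × ℝ → ℝ} (hc : HasCompactSupport η)
    (hF : Continuous F)
    (h0 : ∀ p, η p = 0 → Xg η p = 0 → Yg η p = 0 → F p = 0) : Integrable F := by
  refine hF.integrable_of_hasCompactSupport (HasCompactSupport.intro hc fun p hp => ?_)
  have hev : η =ᶠ[nhds p] 0 := notMem_tsupport_iff_eventuallyEq.mp hp
  refine h0 p hev.self_of_nhds ?_ ?_
  · have h : (fun t => η (t, p.2)) =ᶠ[nhds p.1] fun _ => 0 :=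
      (Continuous.tendsto (by fun_prop : Continuous fun t : ℝ => (t, p.2)) p.1).eventually hev
    simp [Xg, pdx, h.deriv_eq]
  · have h : (fun t => η (p.1, t)) =ᶠ[nhds p.2] fun _ => 0 :=
      (Continuous.tendsto (by fun_prop : Continuous fun t : ℝ => (p.1, t)) p.2).eventually hev
    simp [Yg, pdy, h.deriv_eq]

/-- The Grushin divergence of `η² g ∇_G g`. -/
noncomputable def energyDiv (η g : ℝ × ℝ → ℝ) (p : ℝ × ℝ) : ℝ :=
  η p ^ 2 * (g p * deltaG g p + gradSq g p)
    + 2 * η p * g p * (Xg η p * Xg g p + Yg η p * Yg g p)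

lemma continuous_energyDiv {η g : ℝ × ℝ → ℝ} (hη : ContDiff ℝ 1 η) (hg : ContDiff ℝ 2 g) :
    Continuous (energyDiv η g) := by
  have h0 := hη.continuous
  have h0' := hg.continuous
  have h1 := (contDiff_Xg (k := 0) hη (by norm_num)).continuous
  have h2 := (contDiff_Yg (k := 0) hη (by norm_num)).continuous
  have hX := contDiff_Xg (k := 1) hg (by norm_num)
  have hY := contDiff_Yg (k := 1) hg (by norm_num)
  have h3 := hX.continuous
  have h4 := hY.continuous
  have h5 := (contDiff_Xg (k := 0) hX (by norm_num)).continuous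
  have h6 := (contDiff_Yg (k := 0) hY (by norm_num)).continuous
  unfold energyDiv gradSq deltaG
  fun_prop

lemma integral_energyDiv {η g : ℝ × ℝ → ℝ} (hη : ContDiff ℝ 1 η) (hc : HasCompactSupport η)
    (hg : ContDiff ℝ 2 g) : ∫ p, energyDiv η g p = 0 := by
  have hX := contDiff_Xg (k := 1) hg (by norm_num)
  have hY := contDiff_Yg (k := 1) hg (by norm_num)
  have hg1 : ContDiff ℝ 1 g := hg.of_le (by norm_num)
  have dη := hη.differentiable (by norm_num)
  have dg := hg1.differentiable (by norm_num)
  have dX := hX.differentiable (by norm_num)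
  have dY := hY.differentiable (by norm_num)
  have hF1 : ContDiff ℝ 1 (fun q => (η q * η q) * (g q * Xg g q)) := by fun_prop
  have hF2 : ContDiff ℝ 1 (fun q => (η q * η q) * (g q * Yg g q)) := by fun_prop
  have hc2 : HasCompactSupport fun q => η q * η q := hc.mul_right
  have i1 := integral_Xg_eq_zero hF1 hc2.mul_right
  have i2 := integral_Yg_eq_zero hF2 hc2.mul_right
  have hk1 : Integrable (Xg fun q => (η q * η q) * (g q * Xg g q)) := by
    refine integrable_of_vanishing hc
      (contDiff_Xg (k := 0) hF1 (by norm_num)).continuous fun p h _ _ => ?_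
    rw [Xg_mul (by fun_prop) (by fun_prop), Xg_mul dη dη, h]
    simp
  have hk2 : Integrable (Yg fun q => (η q * η q) * (g q * Yg g q)) := by
    refine integrable_of_vanishing hc
      (contDiff_Yg (k := 0) hF2 (by norm_num)).continuous fun p h _ _ => ?_
    rw [Yg_mul (by fun_prop) (by fun_prop), Yg_mul dη dη, h]
    simp
  rw [← add_zero (0 : ℝ)]
  nth_rw 1 [← i1]
  rw [← i2, ← integral_add hk1 hk2]
  refine integral_congr_ae (Eventually.of_forall fun p => ?_)
  simp only
  rw [Xg_mul (by fun_prop) (by fun_prop), Xg_mul (by fun_prop) (by fun_prop),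
    Xg_mul (by fun_prop) (by fun_prop), Yg_mul (by fun_prop) (by fun_prop),
    Yg_mul (by fun_prop) (by fun_prop), Yg_mul (by fun_prop) (by fun_prop)]
  unfold energyDiv deltaG gradSq
  ring

lemma div_sq_add_div_sq_le {A B P Q ε : ℝ} (hε : 0 < ε) (hε1 : ε ≤ 1) :
    (A * P + B * Q) ^ 2 / (A ^ 2 + B ^ 2 + ε ^ 2) + (P * B - Q * A) ^ 2 / (A ^ 2 + B ^ 2 + 1)
      ≤ P ^ 2 + Q ^ 2 := by
  have h1 : 0 < A ^ 2 + B ^ 2 + ε ^ 2 := by positivity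
  have h2 : A ^ 2 + B ^ 2 + ε ^ 2 ≤ A ^ 2 + B ^ 2 + 1 := by nlinarith
  calc _ ≤ (A * P + B * Q) ^ 2 / (A ^ 2 + B ^ 2 + ε ^ 2)
        + (P * B - Q * A) ^ 2 / (A ^ 2 + B ^ 2 + ε ^ 2) := by gcongr
    _ ≤ P ^ 2 + Q ^ 2 := by
      rw [← add_div, div_le_iff₀ h1]
      nlinarith [sq_nonneg (ε * P), sq_nonneg (ε * Q)]

/-- Regularised length of the Grushin gradient. -/
noncomputable def regNorm (ε : ℝ) (f : ℝ × ℝ → ℝ) (p : ℝ × ℝ) : ℝ := √(gradSq f p + ε ^ 2)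

lemma regNorm_sq (ε : ℝ) (f : ℝ × ℝ → ℝ) (p : ℝ × ℝ) :
    regNorm ε f p ^ 2 = gradSq f p + ε ^ 2 :=
  Real.sq_sqrt (add_nonneg (gradSq_nonneg f p) (sq_nonneg ε))

lemma regNorm_pos {ε : ℝ} (hε : 0 < ε) (f : ℝ × ℝ → ℝ) (p : ℝ × ℝ) : 0 < regNorm ε f p :=
  Real.sqrt_pos.mpr (add_pos_of_nonneg_of_pos (gradSq_nonneg f p) (by positivity))

lemma contDiff_regNorm {ε : ℝ} (hε : 0 < ε) {f : ℝ × ℝ → ℝ} (hf : ContDiff ℝ 2 f) :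
    ContDiff ℝ 1 (regNorm ε f) := by
  have hA := contDiff_Xg (k := 1) hf (by norm_num)
  have hB := contDiff_Yg (k := 1) hf (by norm_num)
  unfold regNorm
  refine ContDiff.sqrt (by unfold gradSq; fun_prop) fun p => ?_
  have := gradSq_nonneg f p
  positivity

lemma Xg_regNorm {ε : ℝ} (hε : 0 < ε) {f : ℝ × ℝ → ℝ} (hf : ContDiff ℝ 2 f) (p : ℝ × ℝ) :
    Xg (regNorm ε f) p
      = (Xg f p * Xg (Xg f) p + Yg f p * Xg (Yg f) p) / regNorm ε f p := by
  have hA := (contDiff_Xg (k := 1) hf (by norm_num)).differentiable (by norm_num)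
  have hB := (contDiff_Yg (k := 1) hf (by norm_num)).differentiable (by norm_num)
  have hs := (contDiff_regNorm hε hf).differentiable (by norm_num)
  have h0 := (regNorm_pos hε f p).ne'
  have h1 : (fun q => regNorm ε f q * regNorm ε f q)
      = fun q => (Xg f q * Xg f q + Yg f q * Yg f q) + ε ^ 2 := by
    funext q
    have := regNorm_sq ε f q
    unfold gradSq at this
    linarith
  have h2 := congrArg (fun F => Xg F p) h1
  rw [Xg_mul hs hs, Xg_add (by fun_prop) (by fun_prop), Xg_add (by fun_prop) (by fun_prop),
    Xg_mul hA hA, Xg_mul hB hB] at h2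
  have h3 : Xg (fun _ => ε ^ 2) p = 0 := by simp [Xg, pdx]
  rw [h3] at h2
  field_simp
  linarith

lemma Yg_regNorm {ε : ℝ} (hε : 0 < ε) {f : ℝ × ℝ → ℝ} (hf : ContDiff ℝ 2 f) (p : ℝ × ℝ) :
    Yg (regNorm ε f) p
      = (Xg f p * Yg (Xg f) p + Yg f p * Yg (Yg f) p) / regNorm ε f p := by
  have hA := (contDiff_Xg (k := 1) hf (by norm_num)).differentiable (by norm_num)
  have hB := (contDiff_Yg (k := 1) hf (by norm_num)).differentiable (by norm_num)
  have hs := (contDiff_regNorm hε hf).differentiable (by norm_num)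
  have h0 := (regNorm_pos hε f p).ne'
  have h1 : (fun q => regNorm ε f q * regNorm ε f q)
      = fun q => (Xg f q * Xg f q + Yg f q * Yg f q) + ε ^ 2 := by
    funext q
    have := regNorm_sq ε f q
    unfold gradSq at this
    linarith
  have h2 := congrArg (fun F => Yg F p) h1
  rw [Yg_mul hs hs, Yg_add (by fun_prop) (by fun_prop), Yg_add (by fun_prop) (by fun_prop),
    Yg_mul hA hA, Yg_mul hB hB] at h2
  have h3 : Yg (fun _ => ε ^ 2) p = 0 := by simp [Yg, pdy]
  rw [h3] at h2
  field_simp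
  linarith

lemma gradSq_mul_regNorm_le {ε : ℝ} (hε : 0 < ε) (hε1 : ε ≤ 1) {f η : ℝ × ℝ → ℝ}
    (hf : ContDiff ℝ 2 f) (hη : ContDiff ℝ 1 η) {c LA LB : ℝ} (hc : c ^ 2 = 1) (p : ℝ × ℝ)
    (hA : deltaG (Xg f) p = LA - 2 * Zg (Yg f) p) (hB : deltaG (Yg f) p = LB + 2 * Zg (Xg f) p)
    (hsign : Zg (Yg f) p * Xg f p - Zg (Xg f) p * Yg f p ≤ 0) :
    gradSq (fun q => c * (regNorm ε f q * η q)) p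
      ≤ energyDiv η (Xg f) p + energyDiv η (Yg f) p + (gradSq f p + ε ^ 2) * gradSq η p
        - η p ^ 2 * bending f p - η p ^ 2 * (LA * Xg f p + LB * Yg f p) := by
  have hs := (contDiff_regNorm hε hf).differentiable (by norm_num)
  have dη := hη.differentiable (by norm_num)
  have h0 := regNorm_pos hε f p
  have hsq := regNorm_sq ε f p
  have hX : Xg (fun q => c * (regNorm ε f q * η q)) p
      = c * (regNorm ε f p * Xg η p
        + (Xg f p * Xg (Xg f) p + Yg f p * Xg (Yg f) p) / regNorm ε f p * η p) := by
    rw [Xg_mul (by fun_prop) (by fun_prop), Xg_mul hs dη, Xg_regNorm hε hf]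
    have h3 : Xg (fun _ => c) p = 0 := by simp [Xg, pdx]
    rw [h3]; ring
  have hY : Yg (fun q => c * (regNorm ε f q * η q)) p
      = c * (regNorm ε f p * Yg η p
        + (Xg f p * Yg (Xg f) p + Yg f p * Yg (Yg f) p) / regNorm ε f p * η p) := by
    rw [Yg_mul (by fun_prop) (by fun_prop), Yg_mul hs dη, Yg_regNorm hε hf]
    have h3 : Yg (fun _ => c) p = 0 := by simp [Yg, pdy]
    rw [h3]; ring
  have k1 := div_sq_add_div_sq_le (A := Xg f p) (B := Yg f p) (P := Xg (Xg f) p)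
    (Q := Xg (Yg f) p) hε hε1
  have k2 := div_sq_add_div_sq_le (A := Xg f p) (B := Yg f p) (P := Yg (Xg f) p)
    (Q := Yg (Yg f) p) hε hε1
  have hsq' : Xg f p ^ 2 + Yg f p ^ 2 + ε ^ 2 = regNorm ε f p ^ 2 := hsq.symm
  rw [hsq'] at k1 k2
  have key : gradSq (fun q => c * (regNorm ε f q * η q)) p
      = regNorm ε f p ^ 2 * gradSq η p
        + 2 * η p * (Xg η p * (Xg f p * Xg (Xg f) p + Yg f p * Xg (Yg f) p)
          + Yg η p * (Xg f p * Yg (Xg f) p + Yg f p * Yg (Yg f) p))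
        + η p ^ 2 * ((Xg f p * Xg (Xg f) p + Yg f p * Xg (Yg f) p) ^ 2 / regNorm ε f p ^ 2
          + (Xg f p * Yg (Xg f) p + Yg f p * Yg (Yg f) p) ^ 2 / regNorm ε f p ^ 2) := by
    unfold gradSq
    rw [hX, hY, mul_pow, mul_pow, hc]
    field_simp
    ring
  have hη2 := sq_nonneg (η p)
  have k3 := mul_le_mul_of_nonneg_left (add_le_add k1 k2) hη2
  have k4 := mul_le_mul_of_nonneg_left hsign hη2
  rw [← hsq, key]
  unfold energyDiv bending
  rw [hA, hB, add_div]
  unfold gradSq at *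
  linarith

end Stability

section WeightedPoincare

variable {m : ℕ}

lemma fderiv_comp_pi_apply {h : (Fin m → ℝ) → ℝ} (hh : ContDiff ℝ 1 h)
    {u : Fin m → ℝ × ℝ → ℝ} (hu : ∀ i, Differentiable ℝ (u i)) (p v : ℝ × ℝ) :
    fderiv ℝ (fun q => h fun j => u j q) p v
      = ∑ j, pdH h j (fun k => u k p) * fderiv ℝ (u j) p v := by
  have h1 : HasFDerivAt (fun q => fun j => u j q)
      (ContinuousLinearMap.pi fun j => fderiv ℝ (u j) p) p :=
    hasFDerivAt_pi.mpr fun j => (hu j p).hasFDerivAt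
  have h2 := ((hh.differentiable (by norm_num)) fun j => u j p).hasFDerivAt.comp p h1
  have h3 : fderiv ℝ (fun q => h fun j => u j q) p = _ := h2.fderiv
  rw [h3, ContinuousLinearMap.comp_apply, ← Finset.univ_sum_single
    (ContinuousLinearMap.pi (fun j => fderiv ℝ (u j) p) v), map_sum]
  refine Finset.sum_congr rfl fun j _ => ?_
  have h4 : (Pi.single j (fderiv ℝ (u j) p v) : Fin m → ℝ)
      = fderiv ℝ (u j) p v • Pi.single j (1 : ℝ) := by
    rw [← Pi.single_smul, smul_eq_mul, mul_one]
  rw [ContinuousLinearMap.pi_apply, h4, map_smul, smul_eq_mul, mul_comm]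
  rfl

lemma Xg_comp_pi {h : (Fin m → ℝ) → ℝ} (hh : ContDiff ℝ 1 h)
    {u : Fin m → ℝ × ℝ → ℝ} (hu : ∀ i, Differentiable ℝ (u i)) (p : ℝ × ℝ) :
    Xg (fun q => h fun j => u j q) p = ∑ j, pdH h j (fun k => u k p) * Xg (u j) p := by
  have := hh.differentiable (by norm_num)
  rw [Xg_eq_fderiv (by fun_prop), fderiv_comp_pi_apply hh hu]
  simp only [Xg_eq_fderiv (hu _)]

lemma Yg_comp_pi {h : (Fin m → ℝ) → ℝ} (hh : ContDiff ℝ 1 h)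
    {u : Fin m → ℝ × ℝ → ℝ} (hu : ∀ i, Differentiable ℝ (u i)) (p : ℝ × ℝ) :
    Yg (fun q => h fun j => u j q) p = ∑ j, pdH h j (fun k => u k p) * Yg (u j) p := by
  have := hh.differentiable (by norm_num)
  rw [Yg_eq_fderiv (by fun_prop), fderiv_comp_pi_apply hh hu, Finset.mul_sum]
  refine Finset.sum_congr rfl fun j _ => ?_
  rw [Yg_eq_fderiv (hu _), mul_left_comm]

lemma abs_inner_le_regNorm_mul {ε : ℝ} (hε : 0 < ε) (f g : ℝ × ℝ → ℝ) (p : ℝ × ℝ) :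
    |Xg f p * Xg g p + Yg f p * Yg g p| ≤ regNorm ε f p * regNorm ε g p := by
  refine abs_le_of_sq_le_sq ?_ (mul_pos (regNorm_pos hε f p) (regNorm_pos hε g p)).le
  rw [mul_pow, regNorm_sq, regNorm_sq]
  unfold gradSq
  nlinarith [sq_nonneg (Xg f p * Yg g p - Yg f p * Xg g p), sq_nonneg (ε * Xg f p),
    sq_nonneg (ε * Xg g p), sq_nonneg (ε * Yg f p), sq_nonneg (ε * Yg g p), sq_nonneg (ε ^ 2)]

lemma exists_sign_of_orientable {θ : Fin m → ℝ × ℝ → ℝ} {h : Fin m → Fin m → ℝ × ℝ → ℝ}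
    (hθ : ∀ i, (∀ p, 0 < θ i p) ∨ (∀ p, θ i p < 0))
    (hh : ∀ i j, i ≠ j → ∀ p, h i j p * θ i p * θ j p < 0) :
    ∃ σ : Fin m → ℝ, (∀ i, σ i ^ 2 = 1) ∧
      ∀ i j, i ≠ j → ∀ p, h i j p * (σ i * σ j) ≤ 0 := by
  have h1 : ∀ i, ∃ s : ℝ, s ^ 2 = 1 ∧ ∀ p, 0 < s * θ i p := by
    intro i
    rcases hθ i with h0 | h0
    · exact ⟨1, by norm_num, fun p => by simpa using h0 p⟩
    · exact ⟨-1, by norm_num, fun p => by simpa using h0 p⟩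
  choose σ hσ hpos using h1
  refine ⟨σ, hσ, fun i j hij p => ?_⟩
  by_contra! hc
  have h2 := mul_pos hc (mul_pos (hpos i p) (hpos j p))
  have h3 : h i j p * (σ i * σ j) * (σ i * θ i p * (σ j * θ j p))
      = σ i ^ 2 * σ j ^ 2 * (h i j p * θ i p * θ j p) := by ring
  rw [h3, hσ, hσ] at h2
  linarith [hh i j hij p]

lemma coupling_le {ε : ℝ} (hε : 0 < ε) (f g : ℝ × ℝ → ℝ) (p : ℝ × ℝ) {a s t : ℝ}
    (hs : s ^ 2 = 1) (ht : t ^ 2 = 1) (ha : a * (s * t) ≤ 0) :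
    a * (s * regNorm ε f p) * (t * regNorm ε g p)
      ≤ a * (Xg f p * Xg g p + Yg f p * Yg g p) := by
  have h0 := abs_inner_le_regNorm_mul hε f g p
  have hst : (s * t) ^ 2 = 1 := by rw [mul_pow, hs, ht, one_mul]
  have h1 : s * t * (Xg f p * Xg g p + Yg f p * Yg g p) ≤ regNorm ε f p * regNorm ε g p := by
    refine le_trans (le_abs_self _) ?_
    have habs : |s * t| = 1 := by
      rw [← Real.sqrt_sq_eq_abs, hst, Real.sqrt_one]
    rwa [abs_mul, habs, one_mul]
  have h2 := mul_le_mul_of_nonpos_left h1 ha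
  calc _ = a * (s * t) * (regNorm ε f p * regNorm ε g p) := by ring
    _ ≤ _ := h2
    _ = (s * t) ^ 2 * (a * (Xg f p * Xg g p + Yg f p * Yg g p)) := by ring
    _ = _ := by rw [hst, one_mul]

lemma sum_integral_sq_mul_bending_le
    {H : Fin m → (Fin m → ℝ) → ℝ} (hH : ∀ i, ContDiff ℝ 1 (H i))
    (hsymm : ∀ i j v, pdH (H j) i v = pdH (H i) j v)
    {u : Fin m → ℝ × ℝ → ℝ} (hu : ∀ i, ContDiff ℝ 3 (u i))
    (hsys : ∀ i p, deltaG (u i) p = H i (fun j => u j p))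
    (hstab : ∀ ζ : Fin m → ℝ × ℝ → ℝ, (∀ i, ContDiff ℝ 1 (ζ i)) →
      (∀ i, HasCompactSupport (ζ i)) →
      (-(∑ i, ∑ j, ∫ p, pdH (H j) i (fun k => u k p) * ζ i p * ζ j p))
        ≤ ∑ i, ∫ p, ((Xg (ζ i) p) ^ 2 + (Yg (ζ i) p) ^ 2))
    (horient : ∃ θ : Fin m → ℝ × ℝ → ℝ,
      (∀ i, (∀ p, 0 < θ i p) ∨ (∀ p, θ i p < 0)) ∧
      (∀ i j, i ≠ j → ∀ p, pdH (H i) j (fun k => u k p) * θ i p * θ j p < 0))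
    (hsign : ∀ i p, Zg (Yg (u i)) p * Xg (u i) p - Zg (Xg (u i)) p * Yg (u i) p ≤ 0)
    {η : ℝ × ℝ → ℝ} (hη : ContDiff ℝ 1 η) (hc : HasCompactSupport η) :
    ∑ i, ∫ p, η p ^ 2 * bending (u i) p ≤ ∑ i, ∫ p, gradSq (u i) p * gradSq η p := by
  obtain ⟨θ, hθ, hθ'⟩ := horient
  obtain ⟨σ, hσ, hneg⟩ := exists_sign_of_orientable
    (h := fun i j p => pdH (H i) j (fun k => u k p)) hθ hθ'
  have hu2 : ∀ i, ContDiff ℝ 2 (u i) := fun i => (hu i).of_le (by norm_num)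
  have hu1 : ∀ i, ContDiff ℝ 1 (u i) := fun i => (hu i).of_le (by norm_num)
  have du : ∀ i, Differentiable ℝ (u i) := fun i => (hu i).differentiable (by norm_num)
  have cη := hη.continuous
  have cη' := continuous_gradSq hη
  have cH : ∀ i j, Continuous fun p => pdH (H i) j (fun k => u k p) := by
    intro i j
    have h1 := ((hH i).continuous_fderiv (by norm_num)).clm_apply
      (continuous_const (y := (Pi.single j 1 : Fin m → ℝ)))
    exact h1.comp (continuous_pi fun k => (hu k).continuous)
  have cE : ∀ i, Continuous fun p =>
      gradSq η p + pdH (H i) i (fun k => u k p) * η p ^ 2 := fun i => by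
    have := cH i i
    fun_prop
  have hsum : ∀ ε ∈ Set.Ioc (0 : ℝ) 1, ∑ i, ∫ p, η p ^ 2 * bending (u i) p
      ≤ (∑ i, ∫ p, gradSq (u i) p * gradSq η p)
        + ε ^ 2 * ∑ i, ∫ p, (gradSq η p + pdH (H i) i (fun k => u k p) * η p ^ 2) := by
    rintro ε ⟨hε, hε1⟩
    set ζ : Fin m → ℝ × ℝ → ℝ := fun i q => σ i * (regNorm ε (u i) q * η q) with hζ
    have cs : ∀ i, ContDiff ℝ 1 (regNorm ε (u i)) := fun i => contDiff_regNorm hε (hu2 i)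
    have cζ : ∀ i, ContDiff ℝ 1 (ζ i) := fun i => by
      have := cs i
      fun_prop
    have kζ : ∀ i, HasCompactSupport (ζ i) := fun i => (hc.mul_left).mul_left
    have cgζ : ∀ i, Continuous (gradSq (ζ i)) := fun i => continuous_gradSq (cζ i)
    have st := hstab ζ cζ kζ
    have point : ∀ i p, gradSq (ζ i) p
        + ∑ j, pdH (H j) i (fun k => u k p) * ζ i p * ζ j p + η p ^ 2 * bending (u i) p
        ≤ energyDiv η (Xg (u i)) p + energyDiv η (Yg (u i)) p + gradSq (u i) p * gradSq η p
          + ε ^ 2 * (gradSq η p + pdH (H i) i (fun k => u k p) * η p ^ 2) := by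
      intro i p
      have e : deltaG (u i) = fun q => H i fun j => u j q := funext (hsys i)
      have hA := Xg_deltaG (hu i) p
      have hB := Yg_deltaG (hu i) p
      rw [e, Xg_comp_pi (hH i) du] at hA
      rw [e, Yg_comp_pi (hH i) du] at hB
      have k1 := gradSq_mul_regNorm_le hε hε1 (hu2 i) hη (hσ i) p
        (LA := ∑ j, pdH (H i) j (fun k => u k p) * Xg (u j) p)
        (LB := ∑ j, pdH (H i) j (fun k => u k p) * Yg (u j) p)
        (by linarith) (by linarith) (hsign i p)
      have k2 : ∑ j, pdH (H j) i (fun k => u k p) * ζ i p * ζ j p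
          ≤ ∑ j, (η p ^ 2 * (pdH (H i) j (fun k => u k p)
              * (Xg (u i) p * Xg (u j) p + Yg (u i) p * Yg (u j) p))
            + if j = i then ε ^ 2 * (pdH (H i) i (fun k => u k p) * η p ^ 2) else 0) := by
        refine Finset.sum_le_sum fun j _ => ?_
        rw [hsymm i j]
        by_cases hij : j = i
        · subst hij
          simp only [if_true, hζ]
          have h1 := regNorm_sq ε (u j) p
          have h2 := hσ j
          refine le_of_eq ?_
          calc _ = σ j ^ 2 * (pdH (H j) j (fun k => u k p) * η p ^ 2
                * regNorm ε (u j) p ^ 2) := by ring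
            _ = _ := by rw [h1, h2, gradSq]; ring
        · simp only [if_neg hij, hζ, add_zero]
          have h1 := coupling_le hε (u i) (u j) p (hσ i) (hσ j)
            (hneg i j (Ne.symm hij) p)
          have h2 := mul_le_mul_of_nonneg_left h1 (sq_nonneg (η p))
          refine le_of_eq_of_le ?_ h2
          ring
      rw [Finset.sum_add_distrib, Finset.sum_ite_eq' Finset.univ i, if_pos (Finset.mem_univ i)]
        at k2
      have k3 : η p ^ 2 * ((∑ j, pdH (H i) j (fun k => u k p) * Xg (u j) p) * Xg (u i) p
          + (∑ j, pdH (H i) j (fun k => u k p) * Yg (u j) p) * Yg (u i) p)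
          = ∑ j, η p ^ 2 * (pdH (H i) j (fun k => u k p)
              * (Xg (u i) p * Xg (u j) p + Yg (u i) p * Yg (u j) p)) := by
        rw [Finset.sum_mul, Finset.sum_mul, ← Finset.sum_add_distrib, Finset.mul_sum]
        exact Finset.sum_congr rfl fun j _ => by ring
      rw [k3] at k1
      linarith
    have zX : ∀ i, ContDiff ℝ 2 (Xg (u i)) := fun i => contDiff_Xg (hu i) (by norm_num)
    have zY : ∀ i, ContDiff ℝ 2 (Yg (u i)) := fun i => contDiff_Yg (hu i) (by norm_num)
    have int1 : ∀ i, Integrable (gradSq (ζ i)) := fun i =>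
      integrable_of_vanishing (kζ i) (cgζ i) fun p _ h1 h2 => by simp [gradSq, h1, h2]
    have int2 : ∀ i j, Integrable fun p => pdH (H j) i (fun k => u k p) * ζ i p * ζ j p :=
      fun i j => integrable_of_vanishing (kζ i)
        (((cH j i).mul (cζ i).continuous).mul (cζ j).continuous) fun p h _ _ => by simp [h]
    have int3 : ∀ i, Integrable fun p => η p ^ 2 * bending (u i) p := fun i =>
      integrable_of_vanishing hc ((cη.pow 2).mul (continuous_bending (hu2 i)))
        fun p h _ _ => by simp [h]
    have int4 : ∀ i, Integrable (energyDiv η (Xg (u i))) := fun i =>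
      integrable_of_vanishing hc (continuous_energyDiv hη (zX i))
        fun p h h1 h2 => by simp [energyDiv, h]
    have int5 : ∀ i, Integrable (energyDiv η (Yg (u i))) := fun i =>
      integrable_of_vanishing hc (continuous_energyDiv hη (zY i))
        fun p h h1 h2 => by simp [energyDiv, h]
    have int6 : ∀ i, Integrable fun p => gradSq (u i) p * gradSq η p := fun i =>
      integrable_of_vanishing hc ((continuous_gradSq (hu1 i)).mul cη')
        fun p h h1 h2 => by simp [gradSq, h1, h2]
    have int7 : ∀ i, Integrable fun p =>
        gradSq η p + pdH (H i) i (fun k => u k p) * η p ^ 2 := fun i =>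
      integrable_of_vanishing hc (cE i) fun p h h1 h2 => by simp [gradSq, h, h1, h2]
    have main : ∀ i, (∫ p, gradSq (ζ i) p)
        + (∑ j, ∫ p, pdH (H j) i (fun k => u k p) * ζ i p * ζ j p)
        + (∫ p, η p ^ 2 * bending (u i) p)
        ≤ (∫ p, gradSq (u i) p * gradSq η p)
          + ε ^ 2 * ∫ p, (gradSq η p + pdH (H i) i (fun k => u k p) * η p ^ 2) := by
      intro i
      have int2' : Integrable fun p => ∑ j, pdH (H j) i (fun k => u k p) * ζ i p * ζ j p :=
        integrable_finsetSum _ fun j _ => int2 i j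
      have h := integral_mono (((int1 i).add int2').add (int3 i))
        ((((int4 i).add (int5 i)).add (int6 i)).add ((int7 i).const_mul (ε ^ 2))) (point i)
      rw [integral_add' ((int1 i).add int2') (int3 i), integral_add' (int1 i) int2',
        integral_finsetSum _ fun j _ => int2 i j,
        integral_add' (((int4 i).add (int5 i)).add (int6 i)) ((int7 i).const_mul (ε ^ 2)),
        integral_add' ((int4 i).add (int5 i)) (int6 i), integral_add' (int4 i) (int5 i),
        integral_energyDiv hη hc (zX i), integral_energyDiv hη hc (zY i),
        integral_const_mul] at h
      linarith
    have total := Finset.sum_le_sum fun i (_ : i ∈ Finset.univ) => main i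
    simp only [Finset.sum_add_distrib, ← Finset.mul_sum] at total
    change _ ≤ ∑ i, ∫ p, gradSq (ζ i) p at st
    linarith
  have lim : Tendsto (fun ε : ℝ => (∑ i, ∫ p, gradSq (u i) p * gradSq η p)
      + ε ^ 2 * ∑ i, ∫ p, (gradSq η p + pdH (H i) i (fun k => u k p) * η p ^ 2))
      (nhdsWithin 0 (Set.Ioi 0)) (nhds (∑ i, ∫ p, gradSq (u i) p * gradSq η p)) := by
    refine Tendsto.mono_left ?_ nhdsWithin_le_nhds
    refine Continuous.tendsto' (by fun_prop) _ _ (by simp)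
  refine ge_of_tendsto lim ?_
  filter_upwards [Ioc_mem_nhdsGT (zero_lt_one' ℝ)] with ε hε using hsum ε hε

end WeightedPoincare

section Cutoff

/-- The fourth power of the Grushin norm. -/
def quarticNorm (p : ℝ × ℝ) : ℝ := p.1 ^ 4 + p.2 ^ 2

/-- A smooth profile equal to `1` on `(-∞, 1]` and to `0` on `[16, ∞)`. -/
noncomputable def profile (t : ℝ) : ℝ := Real.smoothTransition ((16 - t) / 15)

lemma profile_nonneg (t : ℝ) : 0 ≤ profile t := Real.smoothTransition.nonneg _

lemma profile_le_one (t : ℝ) : profile t ≤ 1 := Real.smoothTransition.le_one _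

lemma profile_of_le {t : ℝ} (ht : t ≤ 1) : profile t = 1 :=
  Real.smoothTransition.one_of_one_le (by linarith)

lemma profile_of_ge {t : ℝ} (ht : 16 ≤ t) : profile t = 0 :=
  Real.smoothTransition.zero_of_nonpos (by linarith)

lemma contDiff_profile : ContDiff ℝ 1 profile :=
  Real.smoothTransition.contDiff.comp (by fun_prop)

lemma deriv_profile_of_le {t : ℝ} (ht : t ≤ 1) : deriv profile t = 0 :=
  IsLocalMax.deriv_eq_zero
    (Eventually.of_forall fun s => (profile_le_one s).trans_eq (profile_of_le ht).symm)

lemma deriv_profile_of_ge {t : ℝ} (ht : 16 ≤ t) : deriv profile t = 0 :=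
  IsLocalMin.deriv_eq_zero
    (Eventually.of_forall fun s => (profile_of_ge ht).trans_le (profile_nonneg s))

lemma exists_deriv_profile_bound : ∃ M : ℝ, ∀ t, |deriv profile t| ≤ M := by
  obtain ⟨M, hM⟩ := isCompact_Icc.exists_bound_of_continuousOn (s := Set.Icc (1 : ℝ) 16)
    (contDiff_profile.continuous_deriv (by norm_num)).continuousOn
  refine ⟨M, fun t => ?_⟩
  have hM0 : 0 ≤ M := (norm_nonneg _).trans (hM 1 (by norm_num))
  rcases le_total t 1 with h | h
  · simpa [deriv_profile_of_le h] using hM0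
  rcases le_total 16 t with h' | h'
  · simpa [deriv_profile_of_ge h'] using hM0
  · exact hM t ⟨h, h'⟩

/-- The dyadic cutoff equal to `1` on `B_{2^j}` and vanishing outside `B_{2^(j+1)}`. -/
noncomputable def dyadicCutoff (j : ℕ) (p : ℝ × ℝ) : ℝ := profile (quarticNorm p / 16 ^ j)

/-- The average of `n` consecutive dyadic cutoffs, a discrete logarithmic cutoff. -/
noncomputable def logCutoff (n : ℕ) (p : ℝ × ℝ) : ℝ :=
  (n : ℝ)⁻¹ * ∑ j ∈ Finset.range n, dyadicCutoff (n + j) p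

lemma contDiff_quarticNorm {n : WithTop ℕ∞} : ContDiff ℝ n quarticNorm := by
  unfold quarticNorm; fun_prop

lemma contDiff_dyadicCutoff (j : ℕ) : ContDiff ℝ 1 (dyadicCutoff j) :=
  contDiff_profile.comp (contDiff_quarticNorm.div_const _)

lemma contDiff_logCutoff (n : ℕ) : ContDiff ℝ 1 (logCutoff n) :=
  contDiff_const.mul (ContDiff.sum fun j _ => contDiff_dyadicCutoff (n + j))

lemma dyadicCutoff_of_le {j : ℕ} {p : ℝ × ℝ} (h : quarticNorm p ≤ 16 ^ j) :
    dyadicCutoff j p = 1 :=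
  profile_of_le ((div_le_one (by positivity)).mpr h)

lemma dyadicCutoff_of_ge {j : ℕ} {p : ℝ × ℝ} (h : 16 ^ (j + 1) ≤ quarticNorm p) :
    dyadicCutoff j p = 0 :=
  profile_of_ge ((le_div_iff₀ (by positivity)).mpr (by rw [pow_succ] at h; linarith))

lemma sublevel_quarticNorm_subset {c : ℝ} (hc : 1 ≤ c) :
    {p | quarticNorm p < c} ⊆ Set.Icc (-c) c ×ˢ Set.Icc (-c) c := by
  intro p hp
  simp only [quarticNorm, Set.mem_ofPred_eq] at hp
  have h2 : p.2 ^ 2 ≤ c ^ 2 := by nlinarith [sq_nonneg (p.1 ^ 2)]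
  have h1 : p.1 ^ 2 ≤ c ^ 2 := by nlinarith [sq_nonneg (p.1 ^ 2), sq_nonneg (p.1 ^ 2 - 1)]
  exact ⟨abs_le.mp (abs_le_of_sq_le_sq h1 (by linarith)),
    abs_le.mp (abs_le_of_sq_le_sq h2 (by linarith))⟩

lemma hasCompactSupport_dyadicCutoff (j : ℕ) : HasCompactSupport (dyadicCutoff j) := by
  refine HasCompactSupport.intro
    ((isCompact_Icc (a := -(16 : ℝ) ^ (j + 1)) (b := 16 ^ (j + 1))).prod
      (isCompact_Icc (a := -(16 : ℝ) ^ (j + 1)) (b := 16 ^ (j + 1)))) fun p hp => ?_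
  refine dyadicCutoff_of_ge ?_
  by_contra! h
  exact hp (sublevel_quarticNorm_subset (one_le_pow₀ (by norm_num)) h)

lemma hasCompactSupport_logCutoff (n : ℕ) : HasCompactSupport (logCutoff n) := by
  refine HasCompactSupport.intro
    ((isCompact_Icc (a := -(16 : ℝ) ^ (n + n)) (b := 16 ^ (n + n))).prod
      (isCompact_Icc (a := -(16 : ℝ) ^ (n + n)) (b := 16 ^ (n + n)))) fun p hp => ?_
  have h : (16 : ℝ) ^ (n + n) ≤ quarticNorm p := by
    by_contra! h
    exact hp (sublevel_quarticNorm_subset (one_le_pow₀ (by norm_num)) h)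
  refine mul_eq_zero_of_right _ (Finset.sum_eq_zero fun j hj => dyadicCutoff_of_ge ?_)
  refine le_trans (pow_le_pow_right₀ (by norm_num) ?_) h
  have := Finset.mem_range.mp hj
  omega

lemma dyadicCutoff_le_logCutoff {j n : ℕ} (hn : j < n) (p : ℝ × ℝ) :
    dyadicCutoff j p ≤ logCutoff n p := by
  have hn0 : (0 : ℝ) < n := by exact_mod_cast (by omega : 0 < n)
  have h : ∀ k ∈ Finset.range n, dyadicCutoff j p ≤ dyadicCutoff (n + k) p := by
    intro k _
    rcases le_total (16 ^ (j + 1)) (quarticNorm p) with h | h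
    · rw [dyadicCutoff_of_ge h]; exact profile_nonneg _
    · rw [dyadicCutoff_of_le (j := n + k)
        (h.trans (pow_le_pow_right₀ (by norm_num) (by omega)))]
      exact profile_le_one _
  have h1 := Finset.sum_le_sum h
  rw [Finset.sum_const, Finset.card_range, nsmul_eq_mul] at h1
  unfold logCutoff
  rw [inv_mul_eq_div, le_div_iff₀ hn0]
  linarith

/-- The radial derivative of the dyadic cutoff with respect to `quarticNorm`. -/
noncomputable def dyadicSlope (j : ℕ) (p : ℝ × ℝ) : ℝ :=
  deriv profile (quarticNorm p / 16 ^ j) / 16 ^ j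

lemma hasDerivAt_dyadic (j : ℕ) (t : ℝ) :
    HasDerivAt (fun s => profile (s / 16 ^ j)) (deriv profile (t / 16 ^ j) / 16 ^ j) t := by
  have h := HasDerivAt.comp t
    (contDiff_profile.differentiable (by norm_num) (t / 16 ^ j)).hasDerivAt
    ((hasDerivAt_id t).div_const ((16 : ℝ) ^ j))
  simpa [div_eq_mul_inv, Function.comp_def] using h

lemma gradSq_logCutoff (n : ℕ) (p : ℝ × ℝ) :
    gradSq (logCutoff n) p = ((n : ℝ)⁻¹ * ∑ j ∈ Finset.range n, dyadicSlope (n + j) p) ^ 2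
      * gradSq quarticNorm p := by
  have hN : Differentiable ℝ quarticNorm :=
    contDiff_quarticNorm.differentiable (n := 1) (by norm_num)
  have h := HasDerivAt.const_mul (n : ℝ)⁻¹ (HasDerivAt.fun_sum fun j (_ : j ∈ Finset.range n) =>
    hasDerivAt_dyadic (n + j) (quarticNorm p))
  have hX : Xg (logCutoff n) p = _ := Xg_comp hN p h
  have hY : Yg (logCutoff n) p = _ := Yg_comp hN p h
  rw [gradSq, hX, hY, gradSq]
  unfold dyadicSlope
  ring

lemma gradSq_quarticNorm_le (p : ℝ × ℝ) :
    gradSq quarticNorm p ≤ 16 * p.1 ^ 2 * quarticNorm p := by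
  have hX : Xg quarticNorm p = 4 * p.1 ^ 3 := by simp [Xg, pdx, quarticNorm]
  have hY : Yg quarticNorm p = p.1 * (2 * p.2) := by simp [Yg, pdy, quarticNorm]
  rw [gradSq, hX, hY, quarticNorm]
  nlinarith [sq_nonneg (p.1 * p.2)]

lemma dyadicSlope_mul_eq_zero {i j : ℕ} (hij : i ≠ j) (p : ℝ × ℝ) :
    dyadicSlope i p * dyadicSlope j p = 0 := by
  wlog h : i < j generalizing i j
  · rw [mul_comm]; exact this hij.symm (by omega)
  rcases le_total (quarticNorm p) (16 ^ j) with hp | hp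
  · refine mul_eq_zero_of_right _ ?_
    rw [dyadicSlope, deriv_profile_of_le ((div_le_one (by positivity)).mpr hp), zero_div]
  · refine mul_eq_zero_of_left ?_ _
    rw [dyadicSlope, deriv_profile_of_ge, zero_div]
    rw [le_div_iff₀ (by positivity), ← pow_succ']
    exact (pow_le_pow_right₀ (by norm_num) (by omega)).trans hp

lemma sum_dyadicSlope_sq (n : ℕ) (p : ℝ × ℝ) :
    (∑ j ∈ Finset.range n, dyadicSlope (n + j) p) ^ 2
      = ∑ j ∈ Finset.range n, dyadicSlope (n + j) p ^ 2 := by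
  rw [sq, Finset.sum_mul_sum]
  refine Finset.sum_congr rfl fun i hi => ?_
  rw [Finset.sum_eq_single i, sq]
  · intro j _ hj
    exact dyadicSlope_mul_eq_zero (by omega) p
  · exact fun h => absurd hi h

lemma dyadicSlope_sq_mul_le {M : ℝ} (hM : ∀ t, |deriv profile t| ≤ M) (j : ℕ) (p : ℝ × ℝ) :
    dyadicSlope j p ^ 2 * gradSq quarticNorm p
      ≤ (ballG (2 ^ (j + 1))).indicator (fun q => 256 * M ^ 2 / 16 ^ j * q.1 ^ 2) p := by
  have hb : (2 ^ (j + 1) : ℝ) ^ 4 = 16 ^ (j + 1) := by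
    rw [← pow_mul, mul_comm, pow_mul]; norm_num
  by_cases hp : quarticNorm p < 16 ^ (j + 1)
  · have hmem : p ∈ ballG (2 ^ (j + 1)) := by
      change quarticNorm p < (2 ^ (j + 1)) ^ 4
      rwa [hb]
    rw [Set.indicator_of_mem hmem]
    have h1 : dyadicSlope j p ^ 2 ≤ (M / 16 ^ j) ^ 2 := by
      rw [← sq_abs, dyadicSlope, abs_div, abs_of_pos (by positivity : (0 : ℝ) < 16 ^ j)]
      have := hM (quarticNorm p / 16 ^ j)
      gcongr
    have h2 : gradSq quarticNorm p ≤ 16 * p.1 ^ 2 * 16 ^ (j + 1) :=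
      (gradSq_quarticNorm_le p).trans (by gcongr)
    calc _ ≤ (M / 16 ^ j) ^ 2 * (16 * p.1 ^ 2 * 16 ^ (j + 1)) :=
          mul_le_mul h1 h2 (gradSq_nonneg _ _) (by positivity)
      _ = _ := by rw [pow_succ]; field_simp; ring
  · have hmem : p ∉ ballG (2 ^ (j + 1)) := by
      change ¬ quarticNorm p < (2 ^ (j + 1)) ^ 4
      rwa [hb]
    rw [Set.indicator_of_notMem hmem, dyadicSlope, deriv_profile_of_ge, zero_div]
    · simp
    · rw [le_div_iff₀ (by positivity), ← pow_succ']
      exact not_lt.mp hp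

lemma measurableSet_ballG (R : ℝ) : MeasurableSet (ballG R) :=
  (isOpen_lt (by fun_prop) continuous_const).measurableSet

lemma integrableOn_ballG {F : ℝ × ℝ → ℝ} (hF : Continuous F) {R : ℝ} (hR : 1 ≤ R) :
    IntegrableOn F (ballG R) :=
  (hF.continuousOn.integrableOn_compact (isCompact_Icc.prod isCompact_Icc)).mono_set
    (sublevel_quarticNorm_subset (one_le_pow₀ hR))

lemma exists_integral_gradSq_logCutoff_le : ∃ K : ℝ, ∀ f : ℝ × ℝ → ℝ, ContDiff ℝ 1 f → ∀ C : ℝ,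
    (∀ R > (1 : ℝ), (∫ p in ballG R, p.1 ^ 2 * (normG f p) ^ 2) ≤ C * R ^ 4) →
    ∀ n : ℕ, 0 < n → ∫ p, gradSq f p * gradSq (logCutoff n) p ≤ K * C / n := by
  obtain ⟨M, hM⟩ := exists_deriv_profile_bound
  refine ⟨4096 * M ^ 2, fun f hf C hC n hn => ?_⟩
  have hn0 : (0 : ℝ) < n := by exact_mod_cast hn
  simp_rw [normG_sq] at hC
  have cf := continuous_gradSq hf
  have cη := contDiff_logCutoff n
  have hR : ∀ j, (1 : ℝ) < 2 ^ (j + 1) := fun j => one_lt_pow₀ (by norm_num) (by omega)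
  set D : ℕ → ℝ × ℝ → ℝ := fun j =>
    (ballG (2 ^ (j + 1))).indicator fun q => 256 * M ^ 2 / 16 ^ j * (q.1 ^ 2 * gradSq f q) with hD
  have iD : ∀ j, Integrable (D j) := fun j =>
    (integrableOn_ballG (by fun_prop) (hR j).le).integrable_indicator (measurableSet_ballG _)
  have bD : ∀ j, ∫ p, D j p ≤ 4096 * M ^ 2 * C := by
    intro j
    rw [hD, integral_indicator (measurableSet_ballG _), integral_const_mul]
    have h := mul_le_mul_of_nonneg_left (hC _ (hR j))
      (by positivity : 0 ≤ 256 * M ^ 2 / 16 ^ j)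
    refine h.trans_eq ?_
    have hb : (2 ^ (j + 1) : ℝ) ^ 4 = 16 ^ j * 16 := by
      rw [← pow_succ, ← pow_mul, mul_comm, pow_mul]; norm_num
    rw [hb]
    field_simp
    linarith
  have point : ∀ p, gradSq f p * gradSq (logCutoff n) p
      ≤ (n : ℝ)⁻¹ ^ 2 * ∑ j ∈ Finset.range n, D (n + j) p := by
    intro p
    rw [gradSq_logCutoff, mul_pow, sum_dyadicSlope_sq, mul_assoc, mul_left_comm,
      Finset.sum_mul, Finset.mul_sum]
    refine mul_le_mul_of_nonneg_left (Finset.sum_le_sum fun j _ => ?_) (by positivity)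
    have h := mul_le_mul_of_nonneg_left (dyadicSlope_sq_mul_le hM (n + j) p) (gradSq_nonneg f p)
    refine h.trans_eq ?_
    rw [hD]
    by_cases hp : p ∈ ballG (2 ^ (n + j + 1))
    · simp only [Set.indicator_of_mem hp]
      ring
    · simp only [Set.indicator_of_notMem hp, mul_zero]
  have i1 : Integrable fun p => gradSq f p * gradSq (logCutoff n) p :=
    integrable_of_vanishing (hasCompactSupport_logCutoff n) (cf.mul (continuous_gradSq cη))
      fun p h h1 h2 => by simp [gradSq, h1, h2]
  have i2 := (integrable_finsetSum (Finset.range n) fun j _ => iD (n + j)).const_mul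
    ((n : ℝ)⁻¹ ^ 2)
  refine (integral_mono i1 i2 point).trans ?_
  rw [integral_const_mul, integral_finsetSum _ fun j _ => iD (n + j)]
  have h := Finset.sum_le_sum fun j (_ : j ∈ Finset.range n) => bD (n + j)
  rw [Finset.sum_const, Finset.card_range, nsmul_eq_mul] at h
  refine (mul_le_mul_of_nonneg_left h (by positivity)).trans_eq ?_
  field_simp

end Cutoff

/-- Flatness of level sets for stable, orientable solutions of the
symmetric Grushin system on `ℝ²`: under the sign and growth assumptions,
`𝒜(u_i) = 0` and `ℬ(u_i) = 0` wherever `|∇_G u_i| ≠ 0`. -/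
theorem stmt_9 {m : ℕ}
    (H : Fin m → (Fin m → ℝ) → ℝ) (hH : ∀ i, ContDiff ℝ 1 (H i))
    (hsymm : ∀ i j v, pdH (H j) i v = pdH (H i) j v)
    (u : Fin m → ℝ × ℝ → ℝ) (hu : ∀ i, ContDiff ℝ 3 (u i))
    (hsys : ∀ i p, deltaG (u i) p = H i (fun j => u j p))
    -- stability
    (hstab : ∀ ζ : Fin m → ℝ × ℝ → ℝ, (∀ i, ContDiff ℝ 1 (ζ i)) →
      (∀ i, HasCompactSupport (ζ i)) →
      (-(∑ i, ∑ j, ∫ p, pdH (H j) i (fun k => u k p) * ζ i p * ζ j p))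
        ≤ ∑ i, ∫ p, ((Xg (ζ i) p) ^ 2 + (Yg (ζ i) p) ^ 2))
    -- orientability along u
    (horient : ∃ θ : Fin m → ℝ × ℝ → ℝ,
      (∀ i, (∀ p, 0 < θ i p) ∨ (∀ p, θ i p < 0)) ∧
      (∀ i j, i ≠ j → ∀ p, pdH (H i) j (fun k => u k p) * θ i p * θ j p < 0))
    -- sign assumption on the commutator terms
    (hsign : ∀ i p, Zg (Yg (u i)) p * Xg (u i) p - Zg (Xg (u i)) p * Yg (u i) p ≤ 0)
    -- growth-decay assumption
    (C : ℝ)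
    (hgrow : ∀ R > (1 : ℝ), ∀ i,
      (∫ p in ballG R, p.1 ^ 2 * (normG (u i) p) ^ 2) ≤ C * R ^ 4) :
    ∀ i, ∀ p, normG (u i) p ≠ 0 → curvA (u i) p = 0 ∧ curvB (u i) p = 0 := by
  intro i p _
  refine curv_eq_zero_of_bending_eq_zero ?_
  have hu2 : ∀ i, ContDiff ℝ 2 (u i) := fun i => (hu i).of_le (by norm_num)
  have hu1 : ∀ i, ContDiff ℝ 1 (u i) := fun i => (hu i).of_le (by norm_num)
  obtain ⟨K, hK⟩ := exists_integral_gradSq_logCutoff_le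
  obtain ⟨j, hj⟩ := pow_unbounded_of_one_lt (quarticNorm p) (by norm_num : (1 : ℝ) < 16)
  have cb := continuous_bending (hu2 i)
  have cχ := (contDiff_dyadicCutoff j).continuous
  have int1 : Integrable fun q => dyadicCutoff j q ^ 2 * bending (u i) q :=
    integrable_of_vanishing (hasCompactSupport_dyadicCutoff j) (by fun_prop)
      fun q h _ _ => by simp [h]
  have bound : ∀ n : ℕ, j < n →
      ∫ q, dyadicCutoff j q ^ 2 * bending (u i) q ≤ m * (K * C) / n := by
    intro n hn
    have cη := (contDiff_logCutoff n).continuous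
    have int2 : Integrable fun q => logCutoff n q ^ 2 * bending (u i) q :=
      integrable_of_vanishing (hasCompactSupport_logCutoff n) (by fun_prop)
        fun q h _ _ => by simp [h]
    calc ∫ q, dyadicCutoff j q ^ 2 * bending (u i) q
        ≤ ∫ q, logCutoff n q ^ 2 * bending (u i) q := by
          refine integral_mono int1 int2 fun q => ?_
          exact mul_le_mul_of_nonneg_right
            (pow_le_pow_left₀ (profile_nonneg _) (dyadicCutoff_le_logCutoff hn q) 2)
            (bending_nonneg _ _)
      _ ≤ ∑ k, ∫ q, logCutoff n q ^ 2 * bending (u k) q :=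
          Finset.single_le_sum (f := fun k => ∫ q, logCutoff n q ^ 2 * bending (u k) q)
            (fun k _ => integral_nonneg fun q => mul_nonneg (sq_nonneg _) (bending_nonneg _ _))
            (Finset.mem_univ i)
      _ ≤ ∑ k, ∫ q, gradSq (u k) q * gradSq (logCutoff n) q :=
          sum_integral_sq_mul_bending_le hH hsymm hu hsys hstab horient hsign
            (contDiff_logCutoff n) (hasCompactSupport_logCutoff n)
      _ ≤ ∑ _k : Fin m, K * C / n :=
          Finset.sum_le_sum fun k _ =>
            hK (u k) (hu1 k) C (fun R hR => hgrow R hR k) n (by omega)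
      _ = m * (K * C) / n := by simp [mul_div_assoc]
  have hle : ∫ q, dyadicCutoff j q ^ 2 * bending (u i) q ≤ 0 :=
    ge_of_tendsto (tendsto_const_div_atTop_nhds_zero_nat _)
      ((eventually_gt_atTop j).mono bound)
  by_contra hne
  have hpos : 0 < ∫ q, dyadicCutoff j q ^ 2 * bending (u i) q := by
    refine Continuous.integral_pos_of_hasCompactSupport_nonneg_nonzero (x := p) (by fun_prop)
      (HasCompactSupport.mul_right
        ((hasCompactSupport_dyadicCutoff j).comp_left (g := fun t => t ^ 2) (by simp)))
      (fun q => mul_nonneg (sq_nonneg _) (bending_nonneg _ _)) ?_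
    rwa [dyadicCutoff_of_le hj.le, one_pow, one_mul]
  exact absurd hle (not_le.mpr hpos)
end

section
/- Let R > 1 and define χ_R(x,y) = (ln R − ln ‖(x,y)‖_G)/ln R, where ‖(x,y)‖_G = (x⁴ + y²)^{1/4}. Then at every point (x,y) with √R < ‖(x,y)‖_G < R, the Grushin gradient of χ_R satisfies (Xχ_R)² + (Yχ_R)² ≤ x² / (‖(x,y)‖_G⁴ · (ln R)²). -/
open MeasureTheory Real Filter

theorem log_grushinNorm (q : ℝ × ℝ) :
    Real.log (grushinNorm q) = Real.log (q.1 ^ 4 + q.2 ^ 2) / 4 := by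
  have hs : 0 ≤ q.1 ^ 4 + q.2 ^ 2 := by positivity
  unfold grushinNorm
  rcases hs.eq_or_lt with h | h
  · rw [← h]
    simp
  · rw [Real.log_rpow h]
    ring

theorem grushinNorm_pow_four (q : ℝ × ℝ) : grushinNorm q ^ 4 = q.1 ^ 4 + q.2 ^ 2 := by
  have hs : 0 ≤ q.1 ^ 4 + q.2 ^ 2 := by positivity
  unfold grushinNorm
  rw [← Real.rpow_natCast, ← Real.rpow_mul hs]
  norm_num

theorem Xg_log_cutoff (c d : ℝ) (p : ℝ × ℝ) (hp : p.1 ^ 4 + p.2 ^ 2 ≠ 0) :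
    Xg (fun q => (c - Real.log (grushinNorm q)) / d) p
      = -(p.1 ^ 3 / (p.1 ^ 4 + p.2 ^ 2)) / d := by
  simp only [Xg, pdx, log_grushinNorm]
  have h := ((((hasDerivAt_pow 4 p.1).add_const (p.2 ^ 2)).log hp).div_const 4).const_sub c
    |>.div_const d
  refine h.deriv.trans ?_
  norm_num only [Nat.cast_ofNat]
  ring

theorem Yg_log_cutoff (c d : ℝ) (p : ℝ × ℝ) (hp : p.1 ^ 4 + p.2 ^ 2 ≠ 0) :
    Yg (fun q => (c - Real.log (grushinNorm q)) / d) p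
      = -(p.1 * p.2 / (2 * (p.1 ^ 4 + p.2 ^ 2))) / d := by
  simp only [Yg, pdy, log_grushinNorm]
  have h := ((((hasDerivAt_pow 2 p.2).const_add (p.1 ^ 4)).log hp).div_const 4).const_sub c
    |>.div_const d
  rw [h.deriv]
  norm_num only [Nat.cast_ofNat]
  field_simp
  ring

/-- Grushin gradient bound for the logarithmic cutoff `χ_R` in the
annulus `√R < ‖(x,y)‖_G < R`. -/
theorem stmt_10 (R : ℝ) (hR : 1 < R) (p : ℝ × ℝ)
    (h1 : Real.sqrt R < grushinNorm p) (h2 : grushinNorm p < R) :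
    (Xg (fun q => (Real.log R - Real.log (grushinNorm q)) / Real.log R) p) ^ 2
      + (Yg (fun q => (Real.log R - Real.log (grushinNorm q)) / Real.log R) p) ^ 2
      ≤ p.1 ^ 2 / ((grushinNorm p) ^ 4 * (Real.log R) ^ 2) := by
  have hpos : 0 < p.1 ^ 4 + p.2 ^ 2 := by
    rw [← grushinNorm_pow_four]
    exact pow_pos ((Real.sqrt_nonneg R).trans_lt h1) 4
  have hL : 0 < Real.log R := Real.log_pos hR
  rw [Xg_log_cutoff _ _ _ hpos.ne', Yg_log_cutoff _ _ _ hpos.ne', grushinNorm_pow_four]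
  have key : p.1 ^ 2 / ((p.1 ^ 4 + p.2 ^ 2) * Real.log R ^ 2)
      - ((-(p.1 ^ 3 / (p.1 ^ 4 + p.2 ^ 2)) / Real.log R) ^ 2
        + (-(p.1 * p.2 / (2 * (p.1 ^ 4 + p.2 ^ 2))) / Real.log R) ^ 2)
      = 3 * (p.1 * p.2) ^ 2 / (4 * (p.1 ^ 4 + p.2 ^ 2) ^ 2 * Real.log R ^ 2) := by
    field_simp
    ring
  rw [← sub_nonneg, key]
  positivity
end

section
/- Let p, q, a, b, c, d be real numbers with p² + q² ≠ 0 (p, q represent Xu, Yu and a, b, c, d represent XXu, YXu, XYu, YYu at a point). Suppose that a·q² − (b + c)·p·q + d·p² = 0 (vanishing of the intrinsic curvature 𝒜) and a·p·q − c·p² + b·q² − d·p·q = 0 (vanishing of ℬ). Then the horizontal intrinsic Hessian is degenerate, a·d − b·c = 0, and moreover p²·(d² + c²) = q²·(a² + b²) (equivalently, |Xu|·|∇(Yu)| = |Yu|·|∇(Xu)| at that point). -/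
/-- Algebraic consequences of the vanishing of the intrinsic curvature
`𝒜` and of `ℬ`: degeneracy of the horizontal intrinsic Hessian, `a·d − b·c = 0`, and the
balance `p²·(d² + c²) = q²·(a² + b²)`. Here `p, q` play the role of `Xu, Yu` and
`a, b, c, d` of `XXu, YXu, XYu, YYu`. -/
theorem stmt_14 (p q a b c d : ℝ) (hpq : p ^ 2 + q ^ 2 ≠ 0)
    (hA : a * q ^ 2 - (b + c) * p * q + d * p ^ 2 = 0)
    (hB : a * p * q - c * p ^ 2 + b * q ^ 2 - d * p * q = 0) :
    a * d - b * c = 0 ∧ p ^ 2 * (d ^ 2 + c ^ 2) = q ^ 2 * (a ^ 2 + b ^ 2) := by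
  have hu : a * q - c * p = 0 := by
    refine (mul_eq_zero.mp ?_).resolve_left hpq
    linear_combination q * hA + p * hB
  have hv : b * q - d * p = 0 := by
    refine (mul_eq_zero.mp ?_).resolve_left hpq
    linear_combination q * hB - p * hA
  constructor
  · refine (mul_eq_zero.mp ?_).resolve_left hpq
    linear_combination (p * b + q * d) * hu - (p * a + q * c) * hv
  · linear_combination -(a * q + c * p) * hu - (b * q + d * p) * hv
end
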